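/- Lemma 3.1. Suppose b₁,b₂>0 and conditions (V), (F_0), (F_1), (F_2), (F_3), (F_4) hold. Then every Cerami sequence {(u_n,v_n)}⊂E for Φ is bounded in E, i.e. sup_n ‖(u_n,v_n)‖ < ∞. -/

import Mathlib

open Filter Topology

/-- A connected, locally finite weighted graph `G = (V, E)` with symmetric positive edge
weights `w` (vanishing off edges) and a vertex measure `mu` with positive lower bound
`mumin`. -/
structure WeightedGraph (V : Type*) where
  G : SimpleGraph V
  connected : G.Connected
  locallyFinite : ∀ x : V, (G.neighborSet x).Finite
  w : V → V → ℝ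
  w_symm : ∀ x y, w x y = w y x
  w_pos : ∀ x y, G.Adj x y → 0 < w x y
  w_eq_zero : ∀ x y, ¬ G.Adj x y → w x y = 0
  mu : V → ℝ
  mumin : ℝ
  mumin_pos : 0 < mumin
  mu_ge : ∀ x, mumin ≤ mu x

namespace WeightedGraph

variable {V : Type*} (S : WeightedGraph V)

/-- `∫_V φ dμ = Σ_{x ∈ V} φ(x) μ(x)`. -/
noncomputable def integral (φ : V → ℝ) : ℝ := ∑' x, φ x * S.mu x

/-- The graph Laplacian `Δu(x) = (1/μ(x)) Σ_{y ∼ x} w_{xy} (u(y) - u(x))`. -/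
noncomputable def lap (u : V → ℝ) (x : V) : ℝ :=
  (1 / S.mu x) * ∑' y, S.w x y * (u y - u x)

/-- `|∇u|²(x) = (1/(2μ(x))) Σ_{y ∼ x} w_{xy} (u(y) - u(x))²`. -/
noncomputable def gradSq (u : V → ℝ) (x : V) : ℝ :=
  (1 / (2 * S.mu x)) * ∑' y, S.w x y * (u y - u x) ^ 2

/-- `∇u·∇v(x) = (1/(2μ(x))) Σ_{y ∼ x} w_{xy} (u(y) - u(x))(v(y) - v(x))`. -/
noncomputable def gradDot (u v : V → ℝ) (x : V) : ℝ :=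
  (1 / (2 * S.mu x)) * ∑' y, S.w x y * (u y - u x) * (v y - v x)

/-- The `L^r` norm `‖u‖_r = (∫_V |u|^r dμ)^{1/r}` for `1 ≤ r < ∞`. -/
noncomputable def normLr (r : ℝ) (u : V → ℝ) : ℝ :=
  (S.integral fun x => |u x| ^ r) ^ (1 / r)

/-- The density `|Δu|² + a |∇u|² + V(x) u²` defining the norm of the space `E_i`. -/
noncomputable def energyDensity (a : ℝ) (Vp : V → ℝ) (u : V → ℝ) (x : V) : ℝ :=
  (S.lap u x) ^ 2 + a * S.gradSq u x + Vp x * (u x) ^ 2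

/-- Membership in the working space `E_i` (finiteness of the `E_i`-norm). -/
def memE (a : ℝ) (Vp : V → ℝ) (u : V → ℝ) : Prop :=
  Summable fun x => S.energyDensity a Vp u x * S.mu x

/-- The norm `‖u‖_{E_i} = (∫_V (|Δu|² + a_i |∇u|² + V_i(x)u²) dμ)^{1/2}`. -/
noncomputable def normE (a : ℝ) (Vp : V → ℝ) (u : V → ℝ) : ℝ :=
  Real.sqrt (S.integral (S.energyDensity a Vp u))

/-- The inner product `(u,v)_{E_i} = ∫_V (Δu Δv + a_i ∇u·∇v + V_i(x) u v) dμ`. -/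
noncomputable def innerE (a : ℝ) (Vp : V → ℝ) (u v : V → ℝ) : ℝ :=
  S.integral fun x => S.lap u x * S.lap v x + a * S.gradDot u v x + Vp x * u x * v x

/-- The energy functional `Φ` of the biharmonic–Kirchhoff system. -/
noncomputable def Phi (a₁ a₂ b₁ b₂ : ℝ) (V₁ V₂ : V → ℝ) (F : V → ℝ → ℝ → ℝ)
    (u v : V → ℝ) : ℝ :=
  (1/2) * S.integral (S.energyDensity a₁ V₁ u) + (1/2) * S.integral (S.energyDensity a₂ V₂ v)
    + (b₁/4) * (S.integral (S.gradSq u)) ^ 2 + (b₂/4) * (S.integral (S.gradSq v)) ^ 2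
    - S.integral fun x => F x (u x) (v x)

/-- The action `⟨Φ'(u,v), (φ₁,φ₂)⟩` of the derivative of `Φ`. -/
noncomputable def PhiDeriv (a₁ a₂ b₁ b₂ : ℝ) (V₁ V₂ : V → ℝ) (Fs Ft : V → ℝ → ℝ → ℝ)
    (u v φ₁ φ₂ : V → ℝ) : ℝ :=
  S.innerE a₁ V₁ u φ₁ + S.innerE a₂ V₂ v φ₂
    + b₁ * S.integral (S.gradSq u) * S.integral (S.gradDot u φ₁)
    + b₂ * S.integral (S.gradSq v) * S.integral (S.gradDot v φ₂)
    - S.integral (fun x => Fs x (u x) (v x) * φ₁ x)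
    - S.integral (fun x => Ft x (u x) (v x) * φ₂ x)

/-- `(u,v)` solves the biharmonic–Kirchhoff system (pointwise on `V`). -/
def IsSolution (a₁ a₂ b₁ b₂ : ℝ) (V₁ V₂ : V → ℝ) (Fs Ft : V → ℝ → ℝ → ℝ)
    (u v : V → ℝ) : Prop :=
  (∀ x, S.lap (S.lap u) x - (a₁ + b₁ * S.integral (S.gradSq u)) * S.lap u x + V₁ x * u x
      = Fs x (u x) (v x)) ∧
  (∀ x, S.lap (S.lap v) x - (a₂ + b₂ * S.integral (S.gradSq v)) * S.lap v x + V₂ x * v x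
      = Ft x (u x) (v x))

/-- Condition (V): `θᵢ = inf_V Vᵢ > 0` and `Vᵢ(x) → +∞` as `d(x,x₀) → ∞`. -/
def CondV (V₁ V₂ : V → ℝ) (θ₁ θ₂ : ℝ) : Prop :=
  IsGLB (Set.range V₁) θ₁ ∧ IsGLB (Set.range V₂) θ₂ ∧ 0 < θ₁ ∧ 0 < θ₂ ∧
    ∃ x₀ : V, ∀ M : ℝ, ∃ N : ℕ, ∀ x : V, N ≤ S.G.dist x₀ x → M ≤ V₁ x ∧ M ≤ V₂ x

/-- Condition (F₀). -/
def CondF0 (F : V → ℝ → ℝ → ℝ) : Prop :=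
  (∀ x, F x 0 0 = 0) ∧ ∀ x, ContDiff ℝ 1 (fun p : ℝ × ℝ => F x p.1 p.2)

/-- `Fs` and `Ft` are the partial derivatives of `F` in its last two arguments. -/
def IsPartialDerivs (F Fs Ft : V → ℝ → ℝ → ℝ) : Prop :=
  ∀ x s t, HasDerivAt (fun s' => F x s' t) (Fs x s t) s ∧
           HasDerivAt (fun t' => F x s t') (Ft x s t) t

/-- Condition (F₁). -/
def CondF1 (F Fs Ft : V → ℝ → ℝ → ℝ) (a : ℝ → ℝ) (b : V → ℝ) : Prop :=
  ContinuousOn a (Set.Ici 0) ∧ (∀ r : ℝ, 0 ≤ r → 0 ≤ a r) ∧ (∀ x, 0 < b x) ∧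
    Summable (fun x => b x * S.mu x) ∧
    ∀ x s t, |Fs x s t| ≤ a (Real.sqrt (s ^ 2 + t ^ 2)) * b x ∧
             |Ft x s t| ≤ a (Real.sqrt (s ^ 2 + t ^ 2)) * b x ∧
             |F x s t| ≤ a (Real.sqrt (s ^ 2 + t ^ 2)) * b x

/-- Condition (C₁): `lim_{r → 0⁺} a(r)/r² = h < ∞`. -/
def CondC1 (a : ℝ → ℝ) : Prop :=
  ∃ h : ℝ, Tendsto (fun r => a r / r ^ 2) (nhdsWithin 0 (Set.Ioi 0)) (nhds h)

/-- `γ_{∞,i} = (μ_min · inf_V V_i)^{-1/2}`. -/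
noncomputable def gammaInf (θ : ℝ) : ℝ := 1 / Real.sqrt (S.mumin * θ)

/-- Condition (C₂). -/
def CondC2 (a : ℝ → ℝ) (b : V → ℝ) (θ₁ θ₂ : ℝ) : Prop :=
  ∃ ρ : ℝ, 0 < ρ ∧
    0 < ρ ^ 2 / 4 - sSup (a '' Set.Icc 0 ((S.gammaInf θ₁ + S.gammaInf θ₂) * ρ)) * S.integral b

/-- Condition (F₂): `F(x,s,t)/|(s,t)|⁴ → +∞` as `|(s,t)| → ∞`, uniformly in `x`. -/
def CondF2 (F : V → ℝ → ℝ → ℝ) : Prop :=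
  ∀ M : ℝ, ∃ R : ℝ, ∀ x s t, R ≤ Real.sqrt (s ^ 2 + t ^ 2) → M * (s ^ 2 + t ^ 2) ^ 2 ≤ F x s t

/-- Condition (F₂)': `F(x,s,t)/|(s,t)|² → +∞` as `|(s,t)| → ∞`, uniformly in `x`. -/
def CondF2' (F : V → ℝ → ℝ → ℝ) : Prop :=
  ∀ M : ℝ, ∃ R : ℝ, ∀ x s t, R ≤ Real.sqrt (s ^ 2 + t ^ 2) → M * (s ^ 2 + t ^ 2) ≤ F x s t

/-- Condition (F₃): `F ≥ 0` outside the ball of radius `r₀`. -/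
def CondF3 (F : V → ℝ → ℝ → ℝ) (r₀ : ℝ) : Prop :=
  ∀ x s t, r₀ ≤ Real.sqrt (s ^ 2 + t ^ 2) → 0 ≤ F x s t

/-- `𝓕(x,s,t) = λ (s F_s + t F_t) - F` (with `λ = 1/4` resp. `1/2`). -/
noncomputable def curlyF (lam : ℝ) (F Fs Ft : V → ℝ → ℝ → ℝ) (x : V) (s t : ℝ) : ℝ :=
  lam * (s * Fs x s t + t * Ft x s t) - F x s t

/-- Condition (F₄) (with `λ = 1/4`); `k` is a real exponent and `^` is `Real.rpow`. -/
def CondF4 (F Fs Ft : V → ℝ → ℝ → ℝ) (r₀ : ℝ) : Prop :=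
  (∀ (x : V) (s t : ℝ), 0 ≤ curlyF (1/4) F Fs Ft x s t) ∧
  ∃ c : ℝ, 0 < c ∧ ∃ k : ℝ, 1 < k ∧ ∀ (x : V) (s t : ℝ), r₀ ≤ Real.sqrt (s ^ 2 + t ^ 2) →
    |F x s t| ^ k ≤ c * (s ^ 2 + t ^ 2) ^ k * curlyF (1/4) F Fs Ft x s t

/-- Condition (F₄)' (with `λ = 1/2`). -/
def CondF4' (F Fs Ft : V → ℝ → ℝ → ℝ) (r₀ : ℝ) : Prop :=
  (∀ (x : V) (s t : ℝ), 0 ≤ curlyF (1/2) F Fs Ft x s t) ∧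
  ∃ c : ℝ, 0 < c ∧ ∃ k : ℝ, 1 < k ∧ ∀ (x : V) (s t : ℝ), r₀ ≤ Real.sqrt (s ^ 2 + t ^ 2) →
    |F x s t| ^ k ≤ c * (s ^ 2 + t ^ 2) ^ k * curlyF (1/2) F Fs Ft x s t

/-- `γ_{2,i} = (inf_V V_i)^{-1/2}`. -/
noncomputable def gamma2 (θ : ℝ) : ℝ := 1 / Real.sqrt θ

/-- Condition (F₅) (`lb = 4`), resp. (F₅)' (`lb = 2`): there are `μ̄ > lb` and an admissible
`σ` with `μ̄ F ≤ s F_s + t F_t + σ (s² + t²)`. -/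
def CondF5 (lb : ℝ) (F Fs Ft : V → ℝ → ℝ → ℝ) (θ₁ θ₂ : ℝ) : Prop :=
  ∃ μb : ℝ, lb < μb ∧ ∃ σ : ℝ, 0 < σ ∧
    σ < (μb - 2) / (2 * max (gamma2 θ₁ ^ 2) (gamma2 θ₂ ^ 2)) ∧
    ∀ (x : V) (s t : ℝ), μb * F x s t ≤ s * Fs x s t + t * Ft x s t + σ * (s ^ 2 + t ^ 2)

/-- Condition (F₆): `F` is even in `(s,t)`. -/
def CondF6 (F : V → ℝ → ℝ → ℝ) : Prop :=
  ∀ (x : V) (s t : ℝ), F x (-s) (-t) = F x s t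

/-- A Cerami sequence for `Φ`: `Φ(uₙ,vₙ)` is bounded and
`(1 + ‖(uₙ,vₙ)‖)‖Φ'(uₙ,vₙ)‖_{E*} → 0`. -/
def CeramiSeq (a₁ a₂ b₁ b₂ : ℝ) (V₁ V₂ : V → ℝ) (F Fs Ft : V → ℝ → ℝ → ℝ)
    (u v : ℕ → V → ℝ) : Prop :=
  (∀ n, S.memE a₁ V₁ (u n) ∧ S.memE a₂ V₂ (v n)) ∧
  (∃ C : ℝ, ∀ n, |S.Phi a₁ a₂ b₁ b₂ V₁ V₂ F (u n) (v n)| ≤ C) ∧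
  ∃ ε : ℕ → ℝ, Tendsto ε atTop (nhds 0) ∧
    ∀ (n : ℕ) (φ₁ φ₂ : V → ℝ), S.memE a₁ V₁ φ₁ → S.memE a₂ V₂ φ₂ →
      S.normE a₁ V₁ φ₁ + S.normE a₂ V₂ φ₂ ≤ 1 →
      (1 + (S.normE a₁ V₁ (u n) + S.normE a₂ V₂ (v n))) *
        |S.PhiDeriv a₁ a₂ b₁ b₂ V₁ V₂ Fs Ft (u n) (v n) φ₁ φ₂| ≤ ε n

end WeightedGraph

open WeightedGraph

namespace WeightedGraph

section Energy

variable {V : Type*} (S : WeightedGraph V)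

theorem mu_pos (x : V) : 0 < S.mu x := S.mumin_pos.trans_le (S.mu_ge x)

theorem w_nonneg (x y : V) : 0 ≤ S.w x y := by
  by_cases h : S.G.Adj x y
  · exact (S.w_pos x y h).le
  · exact (S.w_eq_zero x y h).ge

theorem gradSq_nonneg (u : V → ℝ) (x : V) : 0 ≤ S.gradSq u x := by
  have := S.mu_pos x
  exact mul_nonneg (by positivity)
    (tsum_nonneg fun y => mul_nonneg (S.w_nonneg x y) (sq_nonneg _))

theorem integral_nonneg {φ : V → ℝ} (h : ∀ x, 0 ≤ φ x) : 0 ≤ S.integral φ :=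
  tsum_nonneg fun x => mul_nonneg (h x) (S.mu_pos x).le

theorem integral_const_mul (c : ℝ) (φ : V → ℝ) :
    S.integral (fun x => c * φ x) = c * S.integral φ := by
  simp only [integral, mul_assoc, tsum_mul_left]

theorem integral_add {φ ψ : V → ℝ} (hφ : Summable fun x => φ x * S.mu x)
    (hψ : Summable fun x => ψ x * S.mu x) :
    S.integral (fun x => φ x + ψ x) = S.integral φ + S.integral ψ := by
  simp only [integral, add_mul, hφ.tsum_add hψ]

theorem integral_sub {φ ψ : V → ℝ} (hφ : Summable fun x => φ x * S.mu x)
    (hψ : Summable fun x => ψ x * S.mu x) :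
    S.integral (fun x => φ x - ψ x) = S.integral φ - S.integral ψ := by
  simp only [integral, sub_mul, hφ.tsum_sub hψ]

theorem lap_const_mul (c : ℝ) (u : V → ℝ) (x : V) :
    S.lap (fun y => c * u y) x = c * S.lap u x := by
  have h (y : V) : S.w x y * (c * u y - c * u x) = c * (S.w x y * (u y - u x)) := by ring
  simp only [lap, h, tsum_mul_left]
  ring

theorem gradDot_self (u : V → ℝ) : S.gradDot u u = S.gradSq u := by
  funext x
  simp only [gradDot, gradSq, mul_assoc, sq]

theorem gradDot_const_mul_right (c : ℝ) (u v : V → ℝ) (x : V) :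
    S.gradDot u (fun y => c * v y) x = c * S.gradDot u v x := by
  have h (y : V) : S.w x y * (u y - u x) * (c * v y - c * v x)
      = c * (S.w x y * (u y - u x) * (v y - v x)) := by ring
  simp only [gradDot, h, tsum_mul_left]
  ring

theorem gradSq_const_mul (c : ℝ) (u : V → ℝ) (x : V) :
    S.gradSq (fun y => c * u y) x = c ^ 2 * S.gradSq u x := by
  have h (y : V) : S.w x y * (c * u y - c * u x) ^ 2
      = c ^ 2 * (S.w x y * (u y - u x) ^ 2) := by ring
  simp only [gradSq, h, tsum_mul_left]
  ring

theorem energyDensity_const_mul (a c : ℝ) (Vp u : V → ℝ) (x : V) :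
    S.energyDensity a Vp (fun y => c * u y) x = c ^ 2 * S.energyDensity a Vp u x := by
  simp only [energyDensity, lap_const_mul, gradSq_const_mul]
  ring

theorem innerE_self_const_mul (a c : ℝ) (Vp u : V → ℝ) :
    S.innerE a Vp u (fun y => c * u y) = c * S.integral (S.energyDensity a Vp u) := by
  rw [innerE, ← integral_const_mul]
  congr 1
  funext x
  simp only [energyDensity, lap_const_mul, gradDot_const_mul_right, gradDot_self]
  ring

variable {S} in
theorem memE.const_mul {a : ℝ} {Vp u : V → ℝ} (h : S.memE a Vp u) (c : ℝ) :
    S.memE a Vp (fun y => c * u y) := by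
  simp only [memE, energyDensity_const_mul, mul_assoc]
  exact h.mul_left _

theorem normE_const_mul (a : ℝ) (Vp u : V → ℝ) {c : ℝ} (hc : 0 ≤ c) :
    S.normE a Vp (fun y => c * u y) = c * S.normE a Vp u := by
  have h : S.energyDensity a Vp (fun y => c * u y)
      = fun x => c ^ 2 * S.energyDensity a Vp u x :=
    funext (S.energyDensity_const_mul a c Vp u)
  rw [normE, normE, h, integral_const_mul, Real.sqrt_mul (sq_nonneg c), Real.sqrt_sq hc]

theorem energyDensity_nonneg {a : ℝ} (ha : 0 ≤ a) {Vp : V → ℝ} (hVp : ∀ x, 0 ≤ Vp x)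
    (u : V → ℝ) (x : V) : 0 ≤ S.energyDensity a Vp u x :=
  add_nonneg (add_nonneg (sq_nonneg _) (mul_nonneg ha (S.gradSq_nonneg u x)))
    (mul_nonneg (hVp x) (sq_nonneg _))

/-- The embedding of `E_i` into `L^∞`, in squared form. -/
theorem sq_le_integral_energyDensity_div {a : ℝ} (ha : 0 ≤ a) {Vp : V → ℝ} {θ : ℝ}
    (hθ : 0 < θ) (hVp : ∀ x, θ ≤ Vp x) {u : V → ℝ} (hu : S.memE a Vp u) (x : V) :
    u x ^ 2 ≤ S.integral (S.energyDensity a Vp u) / (θ * S.mumin) := by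
  have hnn := S.energyDensity_nonneg ha (fun x => hθ.le.trans (hVp x)) u
  rw [le_div_iff₀ (mul_pos hθ S.mumin_pos)]
  calc u x ^ 2 * (θ * S.mumin) = θ * u x ^ 2 * S.mumin := by ring
    _ ≤ S.energyDensity a Vp u x * S.mu x := by
      refine mul_le_mul ?_ (S.mu_ge x) S.mumin_pos.le (hnn x)
      have h1 := mul_le_mul_of_nonneg_right (hVp x) (sq_nonneg (u x))
      have h2 := mul_nonneg ha (S.gradSq_nonneg u x)
      have h3 := sq_nonneg (S.lap u x)
      simp only [energyDensity]
      linarith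
    _ ≤ _ := hu.le_tsum x fun y _ => mul_nonneg (hnn y) (S.mu_pos y).le

theorem PhiDeriv_self_const_mul (a₁ a₂ b₁ b₂ c : ℝ) (V₁ V₂ : V → ℝ) (Fs Ft : V → ℝ → ℝ → ℝ)
    (u v : V → ℝ) :
    S.PhiDeriv a₁ a₂ b₁ b₂ V₁ V₂ Fs Ft u v (fun x => c * u x) (fun x => c * v x)
      = c * (S.integral (S.energyDensity a₁ V₁ u) + S.integral (S.energyDensity a₂ V₂ v)
        + b₁ * S.integral (S.gradSq u) ^ 2 + b₂ * S.integral (S.gradSq v) ^ 2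
        - S.integral (fun x => u x * Fs x (u x) (v x))
        - S.integral (fun x => v x * Ft x (u x) (v x))) := by
  have hgrad (u : V → ℝ) : S.integral (S.gradDot u fun x => c * u x)
      = c * S.integral (S.gradSq u) := by
    rw [← integral_const_mul, ← gradDot_self]
    exact congrArg S.integral (funext (S.gradDot_const_mul_right c u u))
  have hlin (φ u : V → ℝ) : S.integral (fun x => φ x * (c * u x))
      = c * S.integral (fun x => u x * φ x) := by
    rw [← integral_const_mul]
    exact congrArg S.integral (funext fun x => by ring)
  rw [PhiDeriv, innerE_self_const_mul, innerE_self_const_mul, hgrad, hgrad,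
    hlin (fun x => Fs x (u x) (v x)), hlin (fun x => Ft x (u x) (v x))]
  ring

variable {S} in
/-- A function dominated by `a(|(s,t)|) b(x)` is integrable along a bounded pair `(u, v)`, even
after multiplication by a bounded factor. -/
theorem summable_of_growth {a : ℝ → ℝ} {b : V → ℝ} (ha : ContinuousOn a (Set.Ici 0))
    (hb : ∀ x, 0 < b x) (hbs : Summable fun x => b x * S.mu x) {f : V → ℝ → ℝ → ℝ}
    (hf : ∀ x s t, |f x s t| ≤ a (Real.sqrt (s ^ 2 + t ^ 2)) * b x) {u v g : V → ℝ}
    {A B K : ℝ} (hu : ∀ x, u x ^ 2 ≤ A) (hv : ∀ x, v x ^ 2 ≤ B) (hg : ∀ x, g x ^ 2 ≤ K) :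
    Summable fun x => g x * f x (u x) (v x) * S.mu x := by
  obtain ⟨M, hM⟩ := (isCompact_Icc (a := 0) (b := Real.sqrt (A + B))).bddAbove_image
    (ha.mono fun r hr => hr.1)
  refine Summable.of_norm_bounded (hbs.mul_left (Real.sqrt K * M)) fun x => ?_
  have hμ := S.mu_pos x
  have haM : a (Real.sqrt (u x ^ 2 + v x ^ 2)) ≤ M :=
    hM ⟨_, ⟨Real.sqrt_nonneg _, Real.sqrt_le_sqrt (add_le_add (hu x) (hv x))⟩, rfl⟩
  have hfM : |f x (u x) (v x)| ≤ M * b x :=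
    (hf _ _ _).trans (mul_le_mul_of_nonneg_right haM (hb x).le)
  rw [Real.norm_eq_abs, abs_mul, abs_mul, abs_of_pos hμ]
  calc |g x| * |f x (u x) (v x)| * S.mu x ≤ Real.sqrt K * (M * b x) * S.mu x := by
        gcongr
        exact Real.abs_le_sqrt (hg x)
    _ = Real.sqrt K * M * (b x * S.mu x) := by ring

end Energy

end WeightedGraph

/-- Lemma 3.1: under `b₁, b₂ > 0`, (V), (F₀), (F₁), (F₂), (F₃), (F₄), every Cerami
sequence for `Φ` is bounded in `E`. -/
theorem cerami_sequence_bounded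
    {V : Type*} (S : WeightedGraph V)
    (a₁ a₂ b₁ b₂ : ℝ) (ha₁ : 0 < a₁) (ha₂ : 0 < a₂) (hb₁ : 0 < b₁) (hb₂ : 0 < b₂)
    (V₁ V₂ : V → ℝ) (θ₁ θ₂ : ℝ) (hV : S.CondV V₁ V₂ θ₁ θ₂)
    (F Fs Ft : V → ℝ → ℝ → ℝ) (hFder : IsPartialDerivs F Fs Ft)
    (a : ℝ → ℝ) (b : V → ℝ) (r₀ : ℝ) (hr₀ : 0 < r₀)
    (hF0 : CondF0 F) (hF1 : S.CondF1 F Fs Ft a b)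
    (hF2 : CondF2 F) (hF3 : CondF3 F r₀) (hF4 : CondF4 F Fs Ft r₀)
    (u v : ℕ → V → ℝ)
    (hcer : S.CeramiSeq a₁ a₂ b₁ b₂ V₁ V₂ F Fs Ft u v) :
    ∃ C : ℝ, ∀ n, S.normE a₁ V₁ (u n) + S.normE a₂ V₂ (v n) ≤ C := by
  obtain ⟨hV1, hV2, hθ₁, hθ₂, -⟩ := hV
  replace hV1 (x : V) : θ₁ ≤ V₁ x := hV1.1 ⟨x, rfl⟩
  replace hV2 (x : V) : θ₂ ≤ V₂ x := hV2.1 ⟨x, rfl⟩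
  obtain ⟨hac, -, hb, hbs, hF⟩ := hF1
  obtain ⟨hmem, ⟨C, hC⟩, ε, hε, hder⟩ := hcer
  obtain ⟨D, hD⟩ := hε.bddAbove_range
  replace hD (n : ℕ) : ε n ≤ D := hD ⟨n, rfl⟩
  refine ⟨max 0 (4 * C + D + 2), fun n => ?_⟩
  obtain ⟨hu, hv⟩ := hmem n
  have hI₁ := S.integral_nonneg
    (S.energyDensity_nonneg ha₁.le (fun x => hθ₁.le.trans (hV1 x)) (u n))
  have hI₂ := S.integral_nonneg
    (S.energyDensity_nonneg ha₂.le (fun x => hθ₂.le.trans (hV2 x)) (v n))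
  have hu2 := S.sq_le_integral_energyDensity_div ha₁.le hθ₁ hV1 hu
  have hv2 := S.sq_le_integral_energyDensity_div ha₂.le hθ₂ hV2 hv
  have hsF : Summable fun x => F x (u n x) (v n x) * S.mu x := by
    simpa using summable_of_growth (g := fun _ => 1) hac hb hbs (fun x s t => (hF x s t).2.2)
      hu2 hv2 (fun _ => (one_pow 2).le)
  have hsFs := summable_of_growth hac hb hbs (fun x s t => (hF x s t).1) hu2 hv2 hu2
  have hsFt := summable_of_growth hac hb hbs (fun x s t => (hF x s t).2.1) hu2 hv2 hv2
  have hcurly : 0 ≤ S.integral fun x => curlyF (1/4) F Fs Ft x (u n x) (v n x) :=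
    S.integral_nonneg fun x => hF4.1 _ _ _
  have hsum : Summable fun x =>
      (u n x * Fs x (u n x) (v n x) + v n x * Ft x (u n x) (v n x)) * S.mu x := by
    simpa only [add_mul] using hsFs.add hsFt
  simp only [curlyF] at hcurly
  rw [S.integral_sub (by simpa only [mul_assoc] using hsum.mul_left (1/4)) hsF,
    S.integral_const_mul, S.integral_add hsFs hsFt] at hcurly
  rcases (add_nonneg (Real.sqrt_nonneg _) (Real.sqrt_nonneg _) :
    0 ≤ S.normE a₁ V₁ (u n) + S.normE a₂ V₂ (v n)).eq_or_lt with hN | hN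
  · exact hN.symm.le.trans (le_max_left _ _)
  refine le_max_of_le_right ?_
  set N := S.normE a₁ V₁ (u n) + S.normE a₂ V₂ (v n) with hNdef
  have hNinv : 0 < N⁻¹ := inv_pos.mpr hN
  have hP := hder n _ _ (hu.const_mul N⁻¹) (hv.const_mul N⁻¹) (by
    rw [S.normE_const_mul _ _ _ hNinv.le, S.normE_const_mul _ _ _ hNinv.le, ← mul_add,
      inv_mul_cancel₀ hN.ne'])
  rw [S.PhiDeriv_self_const_mul, abs_mul, abs_of_pos hNinv, ← mul_assoc] at hP
  have hone : 1 ≤ (1 + N) * N⁻¹ := by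
    rw [add_mul, mul_inv_cancel₀ hN.ne']
    linarith
  have hP' := (le_mul_of_one_le_left (abs_nonneg _) hone).trans (hP.trans (hD n))
  have hΦ := (abs_le.mp (hC n)).2
  have hP'' := (abs_le.mp hP').1
  rw [Phi] at hΦ
  have hsqrt {y : ℝ} (hy : 0 ≤ y) : Real.sqrt y ≤ y + 1 := by
    nlinarith [Real.sq_sqrt hy, sq_nonneg (Real.sqrt y - 1)]
  have h₁ := hsqrt hI₁
  have h₂ := hsqrt hI₂
  simp only [normE] at hNdef
  linarith
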